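/- A popular matching M in a bipartite graph G with strict preferences is dominant if and only if there is no augmenting path with respect to M in the subgraph G_M (the subgraph of G obtained by deleting all edges where both endpoints prefer their M-partners to each other). -/

import Mathlib

open Classical

/-- A bipartite graph `G = (A ∪ B, E)` with strict preference lists:
`adj` is the edge relation, and each vertex ranks its neighbors by a rank
function (lower rank = more preferred), injective on neighbors. -/
structure PrefSys (A B : Type) where
  adj : A → B → Prop
  rankA : A → B → ℕ
  rankB : B → A → ℕ
  rankA_inj : ∀ a b b', adj a b → adj a b' → rankA a b = rankA a b' → b = b'
  rankB_inj : ∀ b a a', adj a b → adj a' b → rankB b a = rankB b a' → a = a'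

namespace PrefSys

variable {A B : Type} (P : PrefSys A B)

/-- `M` is a matching of `G`: a set of edges, no two sharing a vertex. -/
def IsMatching (M : Finset (A × B)) : Prop :=
  (∀ p ∈ M, P.adj p.1 p.2) ∧
  (∀ p ∈ M, ∀ q ∈ M, p.1 = q.1 → p = q) ∧
  (∀ p ∈ M, ∀ q ∈ M, p.2 = q.2 → p = q)

/-- Vertex `a ∈ A` prefers matching `M` to matching `M'`:
`a` is matched in `M` and either unmatched in `M'` or matched to a strictly
worse partner in `M'`. -/
def prefA (M M' : Finset (A × B)) (a : A) : Prop :=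
  ∃ b, (a, b) ∈ M ∧ ∀ b', (a, b') ∈ M' → P.rankA a b < P.rankA a b'

/-- Vertex `b ∈ B` prefers matching `M` to matching `M'`. -/
def prefB (M M' : Finset (A × B)) (b : B) : Prop :=
  ∃ a, (a, b) ∈ M ∧ ∀ a', (a', b) ∈ M' → P.rankB b a < P.rankB b a'

/-- `φ(M, M')`: the number of vertices preferring `M` to `M'`. -/
noncomputable def phi (M M' : Finset (A × B)) : ℕ :=
  Nat.card {a : A // P.prefA M M' a} + Nat.card {b : B // P.prefB M M' b}

/-- A matching is popular if it never loses a head-to-head election. -/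
def Popular (M : Finset (A × B)) : Prop :=
  P.IsMatching M ∧ ∀ M', P.IsMatching M' → P.phi M' M ≤ P.phi M M'

/-- `a`'s vote on the edge `(a,b)` versus its `M`-partner is `+`. -/
def voteAplus (M : Finset (A × B)) (a : A) (b : B) : Prop :=
  ∀ b', (a, b') ∈ M → P.rankA a b < P.rankA a b'

/-- `b`'s vote on the edge `(a,b)` versus its `M`-partner is `+`. -/
def voteBplus (M : Finset (A × B)) (a : A) (b : B) : Prop :=
  ∀ a', (a', b) ∈ M → P.rankB b a < P.rankB b a'

/-- `(a,b)` is a blocking edge (an edge outside `M` labeled `(+,+)`). -/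
def Blocking (M : Finset (A × B)) (a : A) (b : B) : Prop :=
  P.adj a b ∧ (a, b) ∉ M ∧ P.voteAplus M a b ∧ P.voteBplus M a b

/-- A stable matching: a matching with no blocking edge. -/
def Stable (M : Finset (A × B)) : Prop :=
  P.IsMatching M ∧ ∀ a b, ¬ P.Blocking M a b

/-- A dominant matching: popular, and more popular than every larger matching. -/
def Dominant (M : Finset (A × B)) : Prop :=
  P.Popular M ∧ ∀ M', P.IsMatching M' → M.card < M'.card → P.phi M' M < P.phi M M'

/-- The edge `(a,b)` survives in the subgraph `G_M` (i.e. it is an edge of `G`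
that is in `M` or is not labeled `(-,-)`). -/
def inGM (M : Finset (A × B)) (a : A) (b : B) : Prop :=
  P.adj a b ∧ ((a, b) ∈ M ∨ P.voteAplus M a b ∨ P.voteBplus M a b)

end PrefSys

namespace PrefSys

variable {A B : Type} (P : PrefSys A B)

/-- Vertices of `G`, as a sum type. -/
abbrev V (A B : Type) := Sum A B

/-- Adjacency in the subgraph `G_M` (symmetrized). -/
def vAdjGM (M : Finset (A × B)) : V A B → V A B → Prop
  | .inl a, .inr b => P.inGM M a b
  | .inr b, .inl a => P.inGM M a b
  | _, _ => False

/-- The (unordered) pair `{x,y}` is an edge of the matching `M`. -/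
def vInM (M : Finset (A × B)) : V A B → V A B → Prop
  | .inl a, .inr b => (a, b) ∈ M
  | .inr b, .inl a => (a, b) ∈ M
  | _, _ => False

/-- The (unordered) pair `{x,y}` is an edge labeled `(+,+)` wrt `M`. -/
def vPlusPlus (M : Finset (A × B)) : V A B → V A B → Prop
  | .inl a, .inr b => P.Blocking M a b
  | .inr b, .inl a => P.Blocking M a b
  | _, _ => False

/-- The vertex `x` is matched in `M`. -/
def vMatched (M : Finset (A × B)) : V A B → Prop
  | .inl a => ∃ b, (a, b) ∈ M
  | .inr b => ∃ a, (a, b) ∈ M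

/-- The list of consecutive pairs of a vertex list. -/
def edgesOf (v : List (V A B)) : List (V A B × V A B) := v.zip v.tail

/-- An alternating path with respect to `M` in the subgraph `G_M`:
a list of distinct vertices, consecutive ones adjacent in `G_M`, whose edges
alternate between matching and non-matching edges. -/
def IsAltPath (M : Finset (A × B)) (v : List (V A B)) : Prop :=
  v.Nodup ∧ v.Chain' (P.vAdjGM M) ∧
  (edgesOf v).Chain' (fun e f => vInM M e.1 e.2 ↔ ¬ vInM M f.1 f.2)

/-- An augmenting path with respect to `M` in `G_M`: an alternating path with
at least one edge, both of whose endpoints are unmatched in `M`. -/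
def IsAugPath (M : Finset (A × B)) (v : List (V A B)) : Prop :=
  P.IsAltPath M v ∧ 2 ≤ v.length ∧
  (∀ x, v.head? = some x → ¬ vMatched M x) ∧
  (∀ x, v.getLast? = some x → ¬ vMatched M x)

/-- The edges of a cycle given by a vertex list (consecutive pairs plus the
closing edge from the last vertex to the first). -/
def cycEdgesOf (v : List (V A B)) : List (V A B × V A B) :=
  match v.head?, v.getLast? with
  | some x, some y => edgesOf v ++ [(y, x)]
  | _, _ => []

/-- An alternating cycle with respect to `M` in the subgraph `G_M`. -/
def IsAltCycle (M : Finset (A × B)) (v : List (V A B)) : Prop :=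
  v.Nodup ∧ 4 ≤ v.length ∧
  (∀ e ∈ cycEdgesOf v, P.vAdjGM M e.1 e.2) ∧
  (cycEdgesOf v).Chain' (fun e f => vInM M e.1 e.2 ↔ ¬ vInM M f.1 f.2)

/-- The set of `G`-edges (as pairs in `A × B`) used by a list of vertex pairs. -/
noncomputable def edgeFinset (l : List (V A B × V A B)) : Finset (A × B) :=
  (l.filterMap (fun e => match e with
    | (.inl a, .inr b) => some (a, b)
    | (.inr b, .inl a) => some (a, b)
    | _ => none)).toFinset

/-- `M ⊕ ρ`: switch `M` along the path with vertex list `v`. -/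
noncomputable def augment (M : Finset (A × B)) (v : List (V A B)) : Finset (A × B) :=
  symmDiff M (edgeFinset (edgesOf v))

end PrefSys

namespace PrefSys

variable {A B : Type} (P : PrefSys A B)

section Votes

variable {P} {M N : Finset (A × B)}

lemma IsMatching.snd_unique (hM : P.IsMatching M) {a : A} {b b' : B}
    (h : (a, b) ∈ M) (h' : (a, b') ∈ M) : b = b' :=
  congrArg Prod.snd (hM.2.1 _ h _ h' rfl)

lemma IsMatching.fst_unique (hM : P.IsMatching M) {a a' : A} {b : B}
    (h : (a, b) ∈ M) (h' : (a', b) ∈ M) : a = a' :=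
  congrArg Prod.fst (hM.2.2 _ h _ h' rfl)

lemma IsMatching.mono (hM : P.IsMatching M) (h : N ⊆ M) : P.IsMatching N :=
  ⟨fun p hp => hM.1 p (h hp), fun p hp q hq => hM.2.1 p (h hp) q (h hq),
    fun p hp q hq => hM.2.2 p (h hp) q (h hq)⟩

lemma not_prefA_of_prefA {a : A} (h : P.prefA N M a) : ¬ P.prefA M N a := by
  obtain ⟨b, hb, h⟩ := h
  rintro ⟨b', hb', h'⟩
  exact lt_asymm (h b' hb') (h' b hb)

lemma not_prefB_of_prefB {b : B} (h : P.prefB N M b) : ¬ P.prefB M N b := by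
  obtain ⟨a, ha, h⟩ := h
  rintro ⟨a', ha', h'⟩
  exact lt_asymm (h a' ha') (h' a ha)

lemma prefA_or_prefA (hM : P.IsMatching M) (hN : P.IsMatching N) {a : A} {b : B}
    (h : (a, b) ∈ N) (h' : (a, b) ∉ M) : P.prefA N M a ∨ P.prefA M N a := by
  by_cases hm : ∃ c, (a, c) ∈ M
  · obtain ⟨c, hc⟩ := hm
    rcases lt_trichotomy (P.rankA a b) (P.rankA a c) with hlt | heq | hlt
    · exact .inl ⟨b, h, fun c' hc' => hM.snd_unique hc hc' ▸ hlt⟩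
    · exact absurd (P.rankA_inj a b c (hN.1 _ h) (hM.1 _ hc) heq ▸ hc) h'
    · exact .inr ⟨c, hc, fun b' hb' => hN.snd_unique h hb' ▸ hlt⟩
  · exact .inl ⟨b, h, fun c hc => absurd ⟨c, hc⟩ hm⟩

lemma prefB_or_prefB (hM : P.IsMatching M) (hN : P.IsMatching N) {a : A} {b : B}
    (h : (a, b) ∈ N) (h' : (a, b) ∉ M) : P.prefB N M b ∨ P.prefB M N b := by
  by_cases hm : ∃ c, (c, b) ∈ M
  · obtain ⟨c, hc⟩ := hm
    rcases lt_trichotomy (P.rankB b a) (P.rankB b c) with hlt | heq | hlt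
    · exact .inl ⟨a, h, fun c' hc' => hM.fst_unique hc hc' ▸ hlt⟩
    · exact absurd (P.rankB_inj b a c (hN.1 _ h) (hM.1 _ hc) heq ▸ hc) h'
    · exact .inr ⟨c, hc, fun b' hb' => hN.fst_unique h hb' ▸ hlt⟩
  · exact .inl ⟨a, h, fun c hc => absurd ⟨c, hc⟩ hm⟩

variable (P M N)

/-- The vote of `a` on `N` against `M`: `1`, `0` or `-1`. -/
noncomputable def voteA (a : A) : ℤ :=
  (if P.prefA N M a then 1 else 0) - (if P.prefA M N a then 1 else 0)

/-- The vote of `b` on `N` against `M`: `1`, `0` or `-1`. -/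
noncomputable def voteB (b : B) : ℤ :=
  (if P.prefB N M b then 1 else 0) - (if P.prefB M N b then 1 else 0)

lemma phi_sub_phi [Fintype A] [Fintype B] :
    (P.phi N M : ℤ) - P.phi M N = ∑ a, P.voteA M N a + ∑ b, P.voteB M N b := by
  simp only [phi, voteA, voteB, Finset.sum_sub_distrib, Finset.sum_boole, Nat.card_eq_fintype_card,
    Fintype.card_subtype]
  push_cast
  ring

variable {P M N}

lemma odd_voteA {a : A} (h : P.prefA N M a ∨ P.prefA M N a) : Odd (P.voteA M N a) := by
  rcases h with h | h
  · simp [voteA, h, not_prefA_of_prefA h]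
  · simp [voteA, h, not_prefA_of_prefA h]

lemma odd_voteB {b : B} (h : P.prefB N M b ∨ P.prefB M N b) : Odd (P.voteB M N b) := by
  rcases h with h | h
  · simp [voteB, h, not_prefB_of_prefB h]
  · simp [voteB, h, not_prefB_of_prefB h]

lemma voteA_congr {N' : Finset (A × B)} {a : A} (h : ∀ b, (a, b) ∈ N ↔ (a, b) ∈ N') :
    P.voteA M N a = P.voteA M N' a := by
  have h1 : P.prefA N M a = P.prefA N' M a := by simp only [prefA, h]
  have h2 : P.prefA M N a = P.prefA M N' a := by simp only [prefA, h]
  simp only [voteA, h1, h2]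

lemma voteB_congr {N' : Finset (A × B)} {b : B} (h : ∀ a, (a, b) ∈ N ↔ (a, b) ∈ N') :
    P.voteB M N b = P.voteB M N' b := by
  have h1 : P.prefB N M b = P.prefB N' M b := by simp only [prefB, h]
  have h2 : P.prefB M N b = P.prefB M N' b := by simp only [prefB, h]
  simp only [voteB, h1, h2]

lemma voteA_self (a : A) : P.voteA M M a = 0 := by simp [voteA]

lemma voteB_self (b : B) : P.voteB M M b = 0 := by simp [voteB]

/-- A popular matching does not lose on any vertex set closed under both matchings. -/
lemma Popular.sum_vote_nonpos [Fintype A] [Fintype B] (hM : P.Popular M) (hN : P.IsMatching N)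
    (S : Finset A) (T : Finset B) (hMS : ∀ a b, (a, b) ∈ M → (a ∈ S ↔ b ∈ T))
    (hNS : ∀ a b, (a, b) ∈ N → (a ∈ S ↔ b ∈ T)) :
    ∑ a ∈ S, P.voteA M N a + ∑ b ∈ T, P.voteB M N b ≤ 0 := by
  set K : Finset (A × B) := N.filter (fun p => p.1 ∈ S) ∪ M.filter (fun p => p.1 ∉ S) with hK
  have memK : ∀ a b, (a, b) ∈ K ↔ ((a, b) ∈ N ∧ a ∈ S) ∨ ((a, b) ∈ M ∧ a ∉ S) := by
    intro a b; simp [hK]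
  have hKm : P.IsMatching K := by
    refine ⟨?_, ?_, ?_⟩
    · rintro ⟨a, b⟩ h
      rcases (memK a b).1 h with h | h
      · exact hN.1 _ h.1
      · exact hM.1.1 _ h.1
    · rintro ⟨a, b⟩ h ⟨a', b'⟩ h' (rfl : a = a')
      rcases (memK a b).1 h with h | h <;> rcases (memK a b').1 h' with h' | h'
      · exact hN.2.1 _ h.1 _ h'.1 rfl
      · exact absurd h.2 h'.2
      · exact absurd h'.2 h.2
      · exact hM.1.2.1 _ h.1 _ h'.1 rfl
    · rintro ⟨a, b⟩ h ⟨a', b'⟩ h' (rfl : b = b')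
      rcases (memK a b).1 h with h | h <;> rcases (memK a' b).1 h' with h' | h'
      · exact hN.2.2 _ h.1 _ h'.1 rfl
      · exact absurd ((hMS _ _ h'.1).2 ((hNS _ _ h.1).1 h.2)) h'.2
      · exact absurd ((hMS _ _ h.1).2 ((hNS _ _ h'.1).1 h'.2)) h.2
      · exact hM.1.2.2 _ h.1 _ h'.1 rfl
  have hA : ∑ a, P.voteA M K a = ∑ a ∈ S, P.voteA M N a := by
    rw [← Finset.sum_subset (Finset.subset_univ S)]
    · exact Finset.sum_congr rfl fun a ha => voteA_congr fun b => by simp [memK, ha]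
    · intro a _ ha
      rw [voteA_congr (N' := M) fun b => by simp [memK, ha], voteA_self]
  have hB : ∑ b, P.voteB M K b = ∑ b ∈ T, P.voteB M N b := by
    rw [← Finset.sum_subset (Finset.subset_univ T)]
    · refine Finset.sum_congr rfl fun b hb => voteB_congr fun a => ?_
      have := hMS a b; have := hNS a b; have := memK a b; tauto
    · intro b _ hb
      rw [voteB_congr (N' := M) fun a => ?_, voteB_self]
      have := hMS a b; have := hNS a b; have := memK a b; tauto
  have h1 := P.phi_sub_phi M K
  have h2 := hM.2 K hKm
  rw [hA, hB] at h1
  lia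

lemma Popular.sum_vote_eq_zero [Fintype A] [Fintype B] (hM : P.Popular M) (hN : P.IsMatching N)
    (hMN : P.phi M N ≤ P.phi N M)
    (S : Finset A) (T : Finset B) (hMS : ∀ a b, (a, b) ∈ M → (a ∈ S ↔ b ∈ T))
    (hNS : ∀ a b, (a, b) ∈ N → (a ∈ S ↔ b ∈ T)) :
    ∑ a ∈ S, P.voteA M N a + ∑ b ∈ T, P.voteB M N b = 0 := by
  have h1 := hM.sum_vote_nonpos hN S T hMS hNS
  have h2 := hM.sum_vote_nonpos hN Sᶜ Tᶜ
    (fun a b h => by simpa using not_congr (hMS a b h))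
    (fun a b h => by simpa using not_congr (hNS a b h))
  have h3 := P.phi_sub_phi M N
  rw [← Finset.sum_add_sum_compl S, ← Finset.sum_add_sum_compl T] at h3
  lia

end Votes

lemma even_sum_add_card {ι : Type*} (s : Finset ι) (f : ι → ℤ) (h : ∀ i ∈ s, Odd (f i)) :
    Even (∑ i ∈ s, f i + s.card) := by
  have : ∑ i ∈ s, f i + s.card = ∑ i ∈ s, (f i + 1) := by simp [Finset.sum_add_distrib]
  rw [this]
  exact Finset.even_sum _ fun i hi => (h i hi).add_one

section Chains

variable {P} {M N : Finset (A × B)} {α : ℕ → A} {β : ℕ → B} {k : ℕ}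

lemma chain_injOn (hM : P.IsMatching M) (hN : P.IsMatching N) (h0 : ∀ b, (α 0, b) ∉ M)
    (hNk : ∀ i < k, (α i, β i) ∈ N) (hMk : ∀ i < k, (α (i + 1), β i) ∈ M) :
    ∀ i j, i ≤ k → j ≤ k → α i = α j → i = j := by
  intro i
  induction i with
  | zero =>
    rintro (_ | j) _ hj h
    · rfl
    · exact absurd (h ▸ hMk j hj) (h0 _)
  | succ i ih =>
    rintro (_ | j) hi hj h
    · exact absurd (h ▸ hMk i hi) (h0 _)
    · have hb : β i = β j := hM.snd_unique (h ▸ hMk i hi) (hMk j hj)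
      rw [ih j (by lia) (by lia) (hN.fst_unique (hb ▸ hNk i hi) (hNk j hj))]

lemma chain_notMem (hM : P.IsMatching M) (hN : P.IsMatching N) (h0 : ∀ b, (α 0, b) ∉ M)
    (hNk : ∀ i < k, (α i, β i) ∈ N) (hMk : ∀ i < k, (α (i + 1), β i) ∈ M) :
    ∀ i < k, (α i, β i) ∉ M := by
  intro i hi h
  have := chain_injOn hM hN h0 hNk hMk i (i + 1) (by lia) (by lia) (hM.fst_unique h (hMk i hi))
  lia

/-- An even alternating path from an `M`-unmatched vertex to an `N`-unmatched vertex has an odd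
vote, so it cannot be balanced. -/
lemma Popular.not_even_chain [Fintype A] [Fintype B] (hM : P.Popular M) (hN : P.IsMatching N)
    (hMN : P.phi M N ≤ P.phi N M) (h0 : ∀ b, (α 0, b) ∉ M)
    (hNk : ∀ i < k, (α i, β i) ∈ N) (hMk : ∀ i < k, (α (i + 1), β i) ∈ M)
    (hpos : 0 < k) (hk : ∀ b, (α k, b) ∉ N) : False := by
  have hα := chain_injOn hM.1 hN h0 hNk hMk
  have hnot := chain_notMem hM.1 hN h0 hNk hMk
  have hβ : ∀ i j, i < k → j < k → β i = β j → i = j := fun i j hi hj h =>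
    hα i j hi.le hj.le (hN.fst_unique (h ▸ hNk i hi) (hNk j hj))
  set S := (Finset.range (k + 1)).image α with hS
  set T := (Finset.range k).image β with hT
  have hSc : S.card = k + 1 := by
    rw [hS, Finset.card_image_of_injOn, Finset.card_range]
    intro i hi j hj h
    simp only [Finset.coe_range, Set.mem_Iio] at hi hj
    exact hα i j (by lia) (by lia) h
  have hTc : T.card = k := by
    rw [hT, Finset.card_image_of_injOn, Finset.card_range]
    intro i hi j hj h
    simp only [Finset.coe_range, Set.mem_Iio] at hi hj
    exact hβ i j hi hj h
  have hzero := hM.sum_vote_eq_zero hN hMN S T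
    (by
      intro a b hab
      simp only [hS, hT, Finset.mem_image, Finset.mem_range]
      constructor
      · rintro ⟨_ | i, hi, rfl⟩
        · exact absurd hab (h0 _)
        · exact ⟨i, by lia, hM.1.snd_unique (hMk i (by lia)) hab⟩
      · rintro ⟨i, hi, rfl⟩
        exact ⟨i + 1, by lia, hM.1.fst_unique (hMk i hi) hab⟩)
    (by
      intro a b hab
      simp only [hS, hT, Finset.mem_image, Finset.mem_range]
      constructor
      · rintro ⟨i, hi, rfl⟩
        rcases Nat.lt_succ_iff_lt_or_eq.1 hi with hi | rfl
        · exact ⟨i, hi, hN.snd_unique (hNk i hi) hab⟩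
        · exact absurd hab (hk _)
      · rintro ⟨i, hi, rfl⟩
        exact ⟨i, by lia, hN.fst_unique (hNk i hi) hab⟩)
  have hA := even_sum_add_card S (P.voteA M N) (by
    intro a ha
    obtain ⟨i, hi, rfl⟩ := Finset.mem_image.1 ha
    apply odd_voteA
    rcases Nat.lt_succ_iff_lt_or_eq.1 (Finset.mem_range.1 hi) with hi | rfl
    · exact prefA_or_prefA hM.1 hN (hNk i hi) (hnot i hi)
    · obtain ⟨j, rfl⟩ := Nat.exists_eq_add_one.2 hpos
      exact (prefA_or_prefA hN hM.1 (hMk j (by lia)) (hk _)).symm)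
  have hB := even_sum_add_card T (P.voteB M N) (by
    intro b hb
    obtain ⟨i, hi, rfl⟩ := Finset.mem_image.1 hb
    have hi := Finset.mem_range.1 hi
    exact odd_voteB (prefB_or_prefB hM.1 hN (hNk i hi) (hnot i hi)))
  rw [hSc] at hA
  rw [hTc] at hB
  obtain ⟨x, hx⟩ := hA
  obtain ⟨y, hy⟩ := hB
  push_cast at hx
  lia

end Chains

section Paths

variable {P} {M : Finset (A × B)}

lemma vInM_symm {x y : V A B} (h : vInM M x y) : vInM M y x := by
  rcases x with a | b <;> rcases y with a' | b' <;> exact h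

lemma IsMatching.vInM_unique (hM : P.IsMatching M) {x y z : V A B}
    (h : vInM M x y) (h' : vInM M x z) : y = z := by
  rcases x with a | b <;> rcases y with a' | b' <;> rcases z with a'' | b'' <;>
    simp only [vInM] at h h'
  · rw [hM.snd_unique h h']
  · rw [hM.fst_unique h h']

lemma vMatched_iff {x : V A B} : vMatched M x ↔ ∃ y, vInM M x y := by
  rcases x with a | b <;> simp [vMatched, vInM]

lemma isAugPath_map_range (w : ℕ → V A B) (L : ℕ) (hL : 2 ≤ L) :
    P.IsAugPath M ((List.range L).map w) ↔
      (∀ i < L, ∀ j < L, w i = w j → i = j) ∧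
      (∀ i, i + 1 < L → P.vAdjGM M (w i) (w (i + 1))) ∧
      (∀ i, i + 2 < L → (vInM M (w i) (w (i + 1)) ↔ ¬ vInM M (w (i + 1)) (w (i + 2)))) ∧
      ¬ vMatched M (w 0) ∧ ¬ vMatched M (w (L - 1)) := by
  have hnd : ((List.range L).map w).Nodup ↔ ∀ i < L, ∀ j < L, w i = w j → i = j := by
    rw [List.nodup_map_iff_inj_on List.nodup_range]
    simp
  have h1 : ((List.range L).map w).IsChain (P.vAdjGM M) ↔
      ∀ i, i + 1 < L → P.vAdjGM M (w i) (w (i + 1)) := by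
    rw [List.isChain_iff_getElem]
    simp
  have h2 : (edgesOf ((List.range L).map w)).IsChain
        (fun e f => vInM M e.1 e.2 ↔ ¬ vInM M f.1 f.2) ↔
      ∀ i, i + 2 < L → (vInM M (w i) (w (i + 1)) ↔ ¬ vInM M (w (i + 1)) (w (i + 2))) := by
    rw [List.isChain_iff_getElem]
    simp only [edgesOf, List.length_zip, List.length_map, List.length_range, List.length_tail,
      List.getElem_zip, List.getElem_map, List.getElem_range, List.getElem_tail]
    exact forall_congr' fun i =>
      ⟨fun h hi => h (by lia), fun h hi => h (by lia)⟩
  have h3 : ((List.range L).map w).head? = some (w 0) := by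
    obtain ⟨L, rfl⟩ := Nat.exists_eq_add_of_le' hL
    simp [List.head?_range]
  have h4 : ((List.range L).map w).getLast? = some (w (L - 1)) := by
    obtain ⟨L, rfl⟩ := Nat.exists_eq_add_of_le' hL
    simp [List.getLast?_range]
  unfold IsAugPath IsAltPath
  rw [h3, h4, hnd]
  simp only [Option.some.injEq, forall_eq', List.length_map, List.length_range]
  constructor
  · rintro ⟨⟨a, b, c⟩, -, d, e⟩
    exact ⟨a, h1.1 b, h2.1 c, d, e⟩
  · rintro ⟨a, b, c, d, e⟩
    exact ⟨⟨a, h1.2 b, h2.2 c⟩, hL, d, e⟩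

lemma exists_eq_map_range (v : List (V A B)) (hv : 2 ≤ v.length) :
    ∃ w : ℕ → V A B, v = (List.range v.length).map w := by
  refine ⟨fun i => v.getD i (v[0]), ?_⟩
  apply List.ext_getElem
  · simp
  · intro i h _
    simp [h]

/-- The alternating sequence `α 0, β 0, α 1, β 1, …`. -/
def interleave (α : ℕ → A) (β : ℕ → B) (i : ℕ) : V A B :=
  if i % 2 = 0 then .inl (α (i / 2)) else .inr (β (i / 2))

lemma interleave_even (α : ℕ → A) (β : ℕ → B) (i : ℕ) :
    interleave α β (2 * i) = .inl (α i) := by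
  simp [interleave]

lemma interleave_odd (α : ℕ → A) (β : ℕ → B) (i : ℕ) :
    interleave α β (2 * i + 1) = .inr (β i) := by
  have h1 : (2 * i + 1) % 2 = 1 := by lia
  have h2 : (2 * i + 1) / 2 = i := by lia
  simp [interleave, h1, h2]

lemma isAugPath_interleave {N : Finset (A × B)} {α : ℕ → A} {β : ℕ → B} {k : ℕ}
    (hM : P.IsMatching M) (hN : P.IsMatching N) (hGM : ∀ a b, (a, b) ∈ N → P.inGM M a b)
    (h0 : ∀ b, (α 0, b) ∉ M) (hNk : ∀ i ≤ k, (α i, β i) ∈ N)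
    (hMk : ∀ i < k, (α (i + 1), β i) ∈ M) (hk : ∀ a, (a, β k) ∉ M) :
    P.IsAugPath M ((List.range (2 * k + 2)).map (interleave α β)) := by
  have hα := chain_injOn hM hN h0 (fun i hi => hNk i (le_of_lt hi)) hMk
  have hβ : ∀ i j, i ≤ k → j ≤ k → β i = β j → i = j := fun i j hi hj h =>
    hα i j hi hj (hN.fst_unique (h ▸ hNk i hi) (hNk j hj))
  have hnot : ∀ i ≤ k, (α i, β i) ∉ M := by
    intro i hi
    rcases hi.lt_or_eq with hi | rfl
    · exact chain_notMem hM hN h0 (fun i hi => hNk i (le_of_lt hi)) hMk i hi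
    · exact hk _
  rw [isAugPath_map_range _ _ (by lia)]
  refine ⟨?_, ?_, ?_, ?_, ?_⟩
  · intro i hi j hj h
    obtain ⟨i, rfl | rfl⟩ := i.even_or_odd' <;> obtain ⟨j, rfl | rfl⟩ := j.even_or_odd' <;>
      simp only [interleave_even, interleave_odd, Sum.inl.injEq, Sum.inr.injEq, reduceCtorEq] at h
    · rw [hα i j (by lia) (by lia) h]
    · rw [hβ i j (by lia) (by lia) h]
  · intro i hi
    obtain ⟨i, rfl | rfl⟩ := i.even_or_odd'
    · rw [interleave_even, interleave_odd]
      exact hGM _ _ (hNk i (by lia))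
    · rw [show 2 * i + 1 + 1 = 2 * (i + 1) by ring, interleave_even, interleave_odd]
      have := hMk i (by lia)
      exact ⟨hM.1 _ this, .inl this⟩
  · intro i hi
    obtain ⟨i, rfl | rfl⟩ := i.even_or_odd'
    · rw [show 2 * i + 2 = 2 * (i + 1) by ring, interleave_even, interleave_odd, interleave_even]
      have h1 := hMk i (by lia)
      have h2 := hnot i (by lia)
      simp [vInM, h1, h2]
    · rw [show 2 * i + 1 + 2 = 2 * (i + 1) + 1 by ring, show 2 * i + 1 + 1 = 2 * (i + 1) by ring,
        interleave_odd, interleave_even, interleave_odd]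
      have h1 := hMk i (by lia)
      have h2 := hnot (i + 1) (by lia)
      simp [vInM, h1, h2]
  · rw [show (0 : ℕ) = 2 * 0 by rfl, interleave_even]
    rintro ⟨b, hb⟩
    exact h0 b hb
  · rw [show 2 * k + 2 - 1 = 2 * k + 1 by lia, interleave_odd]
    rintro ⟨a, ha⟩
    exact hk a ha

end Paths

section Switching

variable {P} {M N : Finset (A × B)}

/-- If `N` lives in `G_M` and covers every `M`-matched vertex, then `M` does not beat `N`. -/
lemma phi_le_phi_of_inGM [Fintype A] [Fintype B] (hM : P.IsMatching M) (hN : P.IsMatching N)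
    (hGM : ∀ a b, (a, b) ∈ N → P.inGM M a b)
    (hcov : ∀ x, vMatched M x → vMatched N x) : P.phi M N ≤ P.phi N M := by
  have hA : Nat.card {a : A // P.prefA M N a} ≤ Nat.card {b : B // P.prefB N M b} := by
    have key : ∀ a : {a : A // P.prefA M N a}, ∃ b : {b : B // P.prefB N M b},
        (a.1, b.1) ∈ N := by
      rintro ⟨a, b, hb, hlt⟩
      obtain ⟨b', hb'⟩ := hcov (.inl a) ⟨b, hb⟩
      refine ⟨⟨b', a, hb', ?_⟩, hb'⟩
      rcases (hGM a b' hb').2 with h | h | h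
      · exact absurd (hM.snd_unique hb h ▸ hlt b' hb') (lt_irrefl _)
      · exact absurd (h b hb) (hlt b' hb').asymm
      · exact h
    choose f hf using key
    exact Nat.card_le_card_of_injective f fun x y h =>
      Subtype.ext (hN.fst_unique (hf x) (h ▸ hf y))
  have hB : Nat.card {b : B // P.prefB M N b} ≤ Nat.card {a : A // P.prefA N M a} := by
    have key : ∀ b : {b : B // P.prefB M N b}, ∃ a : {a : A // P.prefA N M a},
        (a.1, b.1) ∈ N := by
      rintro ⟨b, a, ha, hlt⟩
      obtain ⟨a', ha'⟩ := hcov (.inr b) ⟨a, ha⟩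
      refine ⟨⟨a', b, ha', ?_⟩, ha'⟩
      rcases (hGM a' b ha').2 with h | h | h
      · exact absurd (hM.fst_unique ha h ▸ hlt a' ha') (lt_irrefl _)
      · exact h
      · exact absurd (h a ha) (hlt a' ha').asymm
    choose f hf using key
    exact Nat.card_le_card_of_injective f fun x y h =>
      Subtype.ext (hN.snd_unique (hf x) (h ▸ hf y))
  unfold phi
  lia

lemma IsMatching.card_image_fst (hM : P.IsMatching M) : (M.image Prod.fst).card = M.card :=
  Finset.card_image_of_injOn fun p hp q hq h => hM.2.1 p hp q hq h

lemma IsMatching.card_image_snd (hM : P.IsMatching M) : (M.image Prod.snd).card = M.card :=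
  Finset.card_image_of_injOn fun p hp q hq h => hM.2.2 p hp q hq h

lemma card_lt_card_of_vMatched (hM : P.IsMatching M) (hN : P.IsMatching N)
    (hcov : ∀ x, vMatched M x → vMatched N x) (x : V A B) (hx : ¬ vMatched M x)
    (hx' : vMatched N x) : M.card < N.card := by
  rcases x with a | b
  · rw [← hM.card_image_fst, ← hN.card_image_fst]
    apply Finset.card_lt_card
    refine (Finset.ssubset_iff_of_subset fun c hc => ?_).2 ⟨a, ?_, ?_⟩
    · simpa [vMatched] using hcov (.inl c) (by simpa [vMatched] using hc)
    · simpa [vMatched] using hx'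
    · simpa [vMatched] using hx
  · rw [← hM.card_image_snd, ← hN.card_image_snd]
    apply Finset.card_lt_card
    refine (Finset.ssubset_iff_of_subset fun c hc => ?_).2 ⟨b, ?_, ?_⟩
    · simpa [vMatched] using hcov (.inr c) (by simpa [vMatched] using hc)
    · simpa [vMatched] using hx'
    · simpa [vMatched] using hx

/-- Switching `M` along an augmenting path in `G_M`. -/
lemma exists_matching_of_isAugPath [Fintype A] [Fintype B] (hM : P.IsMatching M)
    (hGM : ∀ a b, (a, b) ∈ M → P.inGM M a b) {v : List (V A B)} (hv : P.IsAugPath M v) :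
    ∃ N, P.IsMatching N ∧ (∀ a b, (a, b) ∈ N → P.inGM M a b) ∧
      (∀ x, vMatched M x → vMatched N x) ∧ ∃ x, ¬ vMatched M x ∧ vMatched N x := by
  have hL := hv.2.1
  obtain ⟨w, hw⟩ := exists_eq_map_range v hL
  generalize v.length = L at hL hw
  subst hw
  obtain ⟨hinj, hadj, halt, hfirst, hlast⟩ := (isAugPath_map_range w L hL).1 hv
  have hpar : ∀ i, i + 1 < L → (vInM M (w i) (w (i + 1)) ↔ i % 2 = 1) := by
    intro i
    induction i with
    | zero =>
      intro _
      simp only [Nat.zero_mod, zero_ne_one, iff_false]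
      exact fun h => hfirst (vMatched_iff.2 ⟨_, h⟩)
    | succ i ih =>
      intro hi
      have h1 := ih (by lia)
      have h2 := halt i (by lia)
      have h3 : (i + 1) % 2 = 1 ↔ ¬ i % 2 = 1 := by lia
      tauto
  have hLe : L % 2 = 0 := by
    by_contra hodd
    obtain ⟨l, rfl⟩ := Nat.exists_eq_add_of_le' hL
    exact hlast (vMatched_iff.2 ⟨_, vInM_symm ((hpar l (by lia)).2 (by lia))⟩)
  have hclosed : ∀ i < L, ∀ y, vInM M (w i) y → ∃ j < L, y = w j := by
    intro i hi y hy
    rcases Nat.mod_two_eq_zero_or_one i with he | ho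
    · rcases i with _ | i
      · exact absurd (vMatched_iff.2 ⟨y, hy⟩) hfirst
      · exact ⟨i, by lia,
          hM.vInM_unique hy (vInM_symm ((hpar i hi).2 (by lia)))⟩
    · rcases Nat.lt_or_ge (i + 1) L with h | h
      · exact ⟨i + 1, h, hM.vInM_unique hy ((hpar i h).2 ho)⟩
      · obtain rfl : i = L - 1 := by lia
        exact absurd (vMatched_iff.2 ⟨y, hy⟩) hlast
  set R : V A B → V A B → Prop := fun x y =>
    (vInM M x y ∧ ∀ i < L, x ≠ w i) ∨
    ∃ i, i % 2 = 0 ∧ i + 1 < L ∧ (x = w i ∧ y = w (i + 1) ∨ x = w (i + 1) ∧ y = w i) with hR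
  have Rsymm : ∀ x y, R x y → R y x := by
    rintro x y (⟨h, hx⟩ | ⟨i, h1, h2, h3⟩)
    · refine .inl ⟨vInM_symm h, ?_⟩
      rintro i hi rfl
      obtain ⟨j, hj, rfl⟩ := hclosed i hi x (vInM_symm h)
      exact hx j hj rfl
    · exact .inr ⟨i, h1, h2, h3.symm.imp And.symm And.symm⟩
  have Runique : ∀ x y z, R x y → R x z → y = z := by
    rintro x y z (⟨h, hx⟩ | ⟨i, h1, h2, h3⟩) (⟨h', hx'⟩ | ⟨j, h1', h2', h3'⟩)
    · exact hM.vInM_unique h h'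
    · rcases h3' with h3' | h3'
      · exact absurd h3'.1 (hx _ (by lia))
      · exact absurd h3'.1 (hx _ h2')
    · rcases h3 with h3 | h3
      · exact absurd h3.1 (hx' _ (by lia))
      · exact absurd h3.1 (hx' _ h2)
    · rcases h3 with ⟨rfl, rfl⟩ | ⟨rfl, rfl⟩ <;> rcases h3' with ⟨h, rfl⟩ | ⟨h, rfl⟩ <;>
        have := hinj _ (by lia) _ (by lia) h
      · rw [this]
      · lia
      · lia
      · rw [show i = j by lia]
  have Rcov : ∀ x, (vMatched M x ∨ ∃ i < L, x = w i) → ∃ y, R x y := by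
    intro x hx
    by_cases hxv : ∃ i < L, x = w i
    · obtain ⟨i, hi, rfl⟩ := hxv
      rcases Nat.mod_two_eq_zero_or_one i with he | ho
      · exact ⟨w (i + 1), .inr ⟨i, he, by lia, .inl ⟨rfl, rfl⟩⟩⟩
      · obtain ⟨j, rfl⟩ := Nat.exists_eq_add_one.2 (show 0 < i by lia)
        exact ⟨w j, .inr ⟨j, by lia, hi, .inr ⟨rfl, rfl⟩⟩⟩
    · obtain ⟨y, hy⟩ := vMatched_iff.1 (hx.resolve_right hxv)
      exact ⟨y, .inl ⟨hy, fun i hi h => hxv ⟨i, hi, h⟩⟩⟩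
  have RGM : ∀ x y, R x y → P.vAdjGM M x y := by
    have hsymm : ∀ x y, P.vAdjGM M x y → P.vAdjGM M y x := by
      rintro (a | b) (a' | b') h <;> exact h
    rintro x y (⟨h, -⟩ | ⟨i, -, h2, ⟨rfl, rfl⟩ | ⟨rfl, rfl⟩⟩)
    · rcases x with a | b <;> rcases y with a' | b' <;> first | exact h | exact hGM _ _ h
    · exact hadj i h2
    · exact hsymm _ _ (hadj i h2)
  set N : Finset (A × B) := Finset.univ.filter fun p => R (.inl p.1) (.inr p.2) with hNdef
  have memN : ∀ a b, (a, b) ∈ N ↔ R (.inl a) (.inr b) := by simp [hNdef]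
  have hcov : ∀ x, (vMatched M x ∨ ∃ i < L, x = w i) → vMatched N x := by
    intro x hx
    obtain ⟨y, hy⟩ := Rcov x hx
    have hxy := RGM x y hy
    rcases x with a | b <;> rcases y with a' | b' <;> simp only [vAdjGM] at hxy
    · exact ⟨b', (memN _ _).2 hy⟩
    · exact ⟨a', (memN _ _).2 (Rsymm _ _ hy)⟩
  refine ⟨N, ⟨?_, ?_, ?_⟩, fun a b h => RGM _ _ ((memN a b).1 h), fun x hx => hcov x (.inl hx),
    w 0, hfirst, hcov _ (.inr ⟨0, by lia, rfl⟩)⟩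
  · rintro ⟨a, b⟩ h
    exact (RGM _ _ ((memN a b).1 h)).1
  · rintro ⟨a, b⟩ h ⟨a', b'⟩ h' (rfl : a = a')
    rw [Sum.inr.inj (Runique _ _ _ ((memN a b).1 h) ((memN a b').1 h'))]
  · rintro ⟨a, b⟩ h ⟨a', b'⟩ h' (rfl : b = b')
    rw [Sum.inl.inj (Runique _ _ _ (Rsymm _ _ ((memN a b).1 h)) (Rsymm _ _ ((memN a' b).1 h')))]

/-- Deleting from a matching the edges outside `G_M` only hurts `M` in the comparison. -/
lemma phi_filter_inGM [Fintype A] [Fintype B] (hM : P.IsMatching M) (hN : P.IsMatching N)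
    (h : P.phi M N ≤ P.phi N M) :
    P.phi M (N.filter fun p => P.inGM M p.1 p.2) ≤
      P.phi (N.filter fun p => P.inGM M p.1 p.2) M := by
  set N' := N.filter fun p => P.inGM M p.1 p.2 with hN'
  have memN' : ∀ a b, (a, b) ∈ N' ↔ (a, b) ∈ N ∧ P.inGM M a b := by simp [hN']
  have h1 : ∀ a, P.prefA N M a → P.prefA N' M a := fun a ⟨b, hb, hv⟩ =>
    ⟨b, (memN' a b).2 ⟨hb, hN.1 _ hb, .inr (.inl hv)⟩, hv⟩
  have h2 : ∀ b, P.prefB N M b → P.prefB N' M b := fun b ⟨a, ha, hv⟩ =>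
    ⟨a, (memN' a b).2 ⟨ha, hN.1 _ ha, .inr (.inr hv)⟩, hv⟩
  have h3 : ∀ a, P.prefA M N' a → P.prefA M N a := by
    rintro a ⟨b, hb, hv⟩
    refine ⟨b, hb, fun b' hb' => ?_⟩
    by_cases hg : P.inGM M a b'
    · exact hv b' ((memN' a b').2 ⟨hb', hg⟩)
    · by_contra hlt
      have hne : P.rankA a b' ≠ P.rankA a b := fun heq =>
        hg ⟨hN.1 _ hb', .inl (P.rankA_inj a b' b (hN.1 _ hb') (hM.1 _ hb) heq ▸ hb)⟩
      exact hg ⟨hN.1 _ hb', .inr (.inl fun c hc => hM.snd_unique hb hc ▸ by lia)⟩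
  have h4 : ∀ b, P.prefB M N' b → P.prefB M N b := by
    rintro b ⟨a, ha, hv⟩
    refine ⟨a, ha, fun a' ha' => ?_⟩
    by_cases hg : P.inGM M a' b
    · exact hv a' ((memN' a' b).2 ⟨ha', hg⟩)
    · by_contra hlt
      have hne : P.rankB b a' ≠ P.rankB b a := fun heq =>
        hg ⟨hN.1 _ ha', .inl (P.rankB_inj b a' a (hN.1 _ ha') (hM.1 _ ha) heq ▸ ha)⟩
      exact hg ⟨hN.1 _ ha', .inr (.inr fun c hc => hM.fst_unique ha hc ▸ by lia)⟩
  have cardle : ∀ {α : Type} [Finite α] (p q : α → Prop), (∀ a, p a → q a) →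
      Nat.card {a // p a} ≤ Nat.card {a // q a} := fun p q hpq =>
    Nat.card_le_card_of_injective _ (Subtype.map_injective hpq Function.injective_id)
  have e1 := cardle _ _ h1
  have e2 := cardle _ _ h2
  have e3 := cardle _ _ h3
  have e4 := cardle _ _ h4
  unfold phi at h ⊢
  lia

/-- In a matching `N` inside `G_M` that ties with the popular matching `M`, an `N`-edge at an
`M`-unmatched vertex starts an augmenting path in `G_M`. -/
lemma Popular.exists_isAugPath [Fintype A] [Fintype B] (hM : P.Popular M) (hN : P.IsMatching N)
    (hMN : P.phi M N ≤ P.phi N M) (hGM : ∀ a b, (a, b) ∈ N → P.inGM M a b) {a₀ : A} {b₀ : B}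
    (h₀ : (a₀, b₀) ∈ N) (hu : ∀ b, (a₀, b) ∉ M) : ∃ v, P.IsAugPath M v := by
  let f : A → B := fun a => if h : ∃ b, (a, b) ∈ N then h.choose else b₀
  let g : B → A := fun b => if h : ∃ a, (a, b) ∈ M then h.choose else a₀
  have hf : ∀ a, (∃ b, (a, b) ∈ N) → (a, f a) ∈ N := by
    intro a h
    simp only [f, dif_pos h]
    exact h.choose_spec
  have hg : ∀ b, (∃ a, (a, b) ∈ M) → (g b, b) ∈ M := by
    intro b h
    simp only [g, dif_pos h]
    exact h.choose_spec
  let α : ℕ → A := fun i => (g ∘ f)^[i] a₀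
  let β : ℕ → B := fun i => f (α i)
  have hsucc : ∀ i, α (i + 1) = g (β i) := fun i => Function.iterate_succ_apply' _ _ _
  let good : ℕ → Prop := fun i => (∃ b, (α i, b) ∈ N) ∧ ∃ a, (a, β i) ∈ M
  have hNg : ∀ i, good i → (α i, β i) ∈ N := fun i h => hf _ h.1
  have hMg : ∀ i, good i → (α (i + 1), β i) ∈ M := fun i h => hsucc i ▸ hg _ h.2
  have hex : ∃ k, ¬ good k := by
    by_contra! hall
    refine not_injective_infinite_finite α fun i j h => ?_
    exact chain_injOn (k := i + j) hM.1 hN hu (fun i _ => hNg i (hall i))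
      (fun i _ => hMg i (hall i)) i j (by lia) (by lia) h
  obtain ⟨k, hk, hlt⟩ : ∃ k, ¬ good k ∧ ∀ i < k, good i :=
    ⟨Nat.find hex, Nat.find_spec hex, fun i hi => not_not.1 (Nat.find_min hex hi)⟩
  have hNk : ∀ i < k, (α i, β i) ∈ N := fun i hi => hNg i (hlt i hi)
  have hMk : ∀ i < k, (α (i + 1), β i) ∈ M := fun i hi => hMg i (hlt i hi)
  by_cases hend : ∃ b, (α k, b) ∈ N
  · refine ⟨_, isAugPath_interleave (k := k) hM.1 hN hGM hu (fun i hi => ?_) hMk fun a ha => ?_⟩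
    · rcases hi.lt_or_eq with hi | rfl
      · exact hNk i hi
      · exact hf _ hend
    · exact hk ⟨hend, a, ha⟩
  · refine (hM.not_even_chain hN hMN hu hNk hMk (Nat.pos_of_ne_zero ?_)
      fun b hb => hend ⟨b, hb⟩).elim
    rintro rfl
    exact hend ⟨b₀, h₀⟩

end Switching

end PrefSys

open PrefSys in
/-- a popular matching `M` is dominant iff there is no augmenting
path with respect to `M` in the subgraph `G_M`. -/
theorem dominant_iff_no_aug_path {A B : Type} [Fintype A] [Fintype B]
    (P : PrefSys A B) (M : Finset (A × B)) (hM : P.Popular M) :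
    P.Dominant M ↔ ¬ ∃ v, P.IsAugPath M v := by
  constructor
  · rintro ⟨-, hdom⟩ ⟨v, hv⟩
    obtain ⟨N, hN, hGM, hcov, x, hx, hx'⟩ :=
      exists_matching_of_isAugPath hM.1 (fun a b h => ⟨hM.1.1 _ h, .inl h⟩) hv
    exact absurd (hdom N hN (card_lt_card_of_vMatched hM.1 hN hcov x hx hx'))
      (phi_le_phi_of_inGM hM.1 hN hGM hcov).not_gt
  · intro hno
    refine ⟨hM, fun N hN hcard => ?_⟩
    by_contra! hle
    apply hno
    obtain ⟨a, haN, haM⟩ : ∃ a ∈ N.image Prod.fst, a ∉ M.image Prod.fst := by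
      by_contra! hsub
      have := Finset.card_le_card hsub
      rw [hM.1.card_image_fst, hN.card_image_fst] at this
      lia
    obtain ⟨⟨a, b⟩, hab, rfl⟩ := Finset.mem_image.1 haN
    have hu : ∀ c, (a, c) ∉ M := fun c hc => haM (Finset.mem_image.2 ⟨(a, c), hc, rfl⟩)
    refine hM.exists_isAugPath (hN.mono (Finset.filter_subset _ N))
      (phi_filter_inGM hM.1 hN hle) (a₀ := a) (b₀ := b) (by simp) ?_ hu
    exact Finset.mem_filter.2 ⟨hab, hN.1 _ hab, .inr (.inl fun c hc => absurd hc (hu c))⟩
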